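/- arXiv:2504.08667 — 2 statements merged into one kernel-verified Lean document; each statement's English description precedes it below -/
import Mathlib

section
/- Let G = (V, E, s) be a graph in which every node is reachable from s. Let a ∈ V and let W ⊆ V be a set of nodes with a ∉ W such that a ≥_s w for every w ∈ W, and suppose there is no arc (u, v) ∈ E with a ≥_s u, u ∉ {a} ∪ W, and v ∈ W. Then {a} ∪ W is a module of G with source a. -/
open Relation

variable {V : Type*}

/-- `p` is a path from `a` to `b` in the arc relation `E`:
a nonempty list of nodes starting at `a`, ending at `b`,
in which every consecutive pair of nodes is an arc. -/
def IsPath (E : V → V → Prop) (a b : V) (p : List V) : Prop :=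
  p ≠ [] ∧ p.head? = some a ∧ p.getLast? = some b ∧ p.Chain' E

/-- `a` dominates `b` (written `a ≥_s b`): every path from `s` to `b` contains `a`. -/
def Dom (E : V → V → Prop) (s a b : V) : Prop :=
  ∀ p : List V, IsPath E s b p → a ∈ p

/-- `m` is a source of module `M`: `m ∈ M`, every arc entering `M` from outside goes
to `m`, and (convention) if `s ∈ M` then `m = s`. -/
def ModuleSource (E : V → V → Prop) (s : V) (M : Set V) (m : V) : Prop :=
  m ∈ M ∧ (∀ u v, E u v → u ∉ M → v ∈ M → v = m) ∧ (s ∈ M → m = s)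

/-- `M` is a module of the graph `(V, E, s)`. -/
def IsModule (E : V → V → Prop) (s : V) (M : Set V) : Prop :=
  ∃ m, ModuleSource E s M m

/-- Two sets overlap: they intersect but neither contains the other. -/
def Overlap (M H : Set V) : Prop :=
  (M ∩ H).Nonempty ∧ ¬ M ⊆ H ∧ ¬ H ⊆ M

/-- A nesting decomposition: a collection of pairwise non-overlapping modules
containing the trivial modules (the whole node set and all singletons). -/
def IsNestingDecomp (E : V → V → Prop) (s : V) (F : Set (Set V)) : Prop :=
  (∀ M ∈ F, IsModule E s M) ∧
  (∀ M ∈ F, ∀ H ∈ F, ¬ Overlap M H) ∧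
  (Set.univ : Set V) ∈ F ∧
  (∀ v : V, ({v} : Set V) ∈ F)

/-- The maximal module partition of `M` within the family `F`. -/
def MaxPartition (F : Set (Set V)) (M : Set V) : Set (Set V) :=
  {H | H ∈ F ∧ H ⊂ M ∧ ¬ ∃ K ∈ F, H ⊂ K ∧ K ⊂ M}

/-- The width of a nesting decomposition `F`. -/
noncomputable def NDWidth (F : Set (Set V)) : ℕ :=
  ⨆ M ∈ F, (MaxPartition F M).ncard

/-- The nesting width of the graph `(V, E, s)`. -/
noncomputable def nestingWidth (E : V → V → Prop) (s : V) : ℕ :=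
  sInf {w : ℕ | ∃ F : Set (Set V), IsNestingDecomp E s F ∧ NDWidth F = w}

/-- `D(a)`: the set of nodes dominated by `a`. -/
def DomSet (E : V → V → Prop) (s a : V) : Set V := {v | Dom E s a v}

/-- `v` is a child of `a` in the dominator tree. -/
def IsChild (E : V → V → Prop) (s a v : V) : Prop :=
  v ≠ a ∧ Dom E s a v ∧ ∀ b, b ≠ a → b ≠ v → ¬(Dom E s a b ∧ Dom E s b v)

/-- `C(a)`: the set of children of `a` in the dominator tree. -/
def Children (E : V → V → Prop) (s a : V) : Set V := {v | IsChild E s a v}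

/-- The arc relation of the graph `G_a` on the children of `a`. -/
def GArc (E : V → V → Prop) (s a : V) (u v : V) : Prop :=
  u ∈ Children E s a ∧ v ∈ Children E s a ∧ u ≠ v ∧
    ∃ x y, E x y ∧ x ∈ DomSet E s u ∧ y ∈ DomSet E s v

/-- `S` is a strongly connected component of `G_a`
(an equivalence class of mutual reachability in `G_a`). -/
def IsSCC (E : V → V → Prop) (s a : V) (S : Set V) : Prop :=
  ∃ u ∈ Children E s a,
    S = {v | v ∈ Children E s a ∧ ReflTransGen (GArc E s a) u v ∧
          ReflTransGen (GArc E s a) v u}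

/-- `L` lists the strongly connected components of `G_a` in topological order:
each member is an SCC of `G_a`, every child of `a` lies in exactly one listed
component, and every arc of `G_a` goes from an earlier component to the same
or a later component. -/
def IsTopoSCCList (E : V → V → Prop) (s a : V) (L : List (Set V)) : Prop :=
  (∀ S ∈ L, IsSCC E s a S) ∧
  (∀ v ∈ Children E s a, ∃! i : Fin L.length, v ∈ L.get i) ∧
  (∀ i j : Fin L.length, ∀ u ∈ L.get i, ∀ v ∈ L.get j, GArc E s a u v → i ≤ j)

/-- `D(S) = ⋃_{v ∈ S} D(v)`. -/
def DSet (E : V → V → Prop) (s : V) (S : Set V) : Set V := ⋃ v ∈ S, DomSet E s v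

/-- The set `{a} ∪ ⋃_{i=1}^{j} D(S^a_i)` (components indexed from 0 in the list). -/
def PrefixModule (E : V → V → Prop) (s a : V) (L : List (Set V)) (j : ℕ) : Set V :=
  {a} ∪ ⋃ i ∈ Finset.range j, DSet E s (L.getD i ∅)

/-- The A-C family determined by a choice `L` of topologically ordered SCC lists. -/
def ACFamily (E : V → V → Prop) (s : V) (L : V → List (Set V)) : Set (Set V) :=
  {M | ∃ (a : V) (j : ℕ), j ≤ (L a).length ∧ M = PrefixModule E s a (L a) j}

/-- The quantity `max { |S^a_i| : a ∈ V, 1 ≤ i ≤ k_a }`. -/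
noncomputable def MaxSCCSize (L : V → List (Set V)) : ℕ :=
  ⨆ a : V, ⨆ i ∈ Finset.range (L a).length, ((L a).getD i ∅).ncard

/-- The one-node list is a path. -/
theorem isPath_singleton (E : V → V → Prop) (a : V) : IsPath E a a [a] :=
  ⟨by simp, rfl, rfl, List.isChain_singleton a⟩

/-- A path can be extended by an arc leaving its last node. -/
theorem IsPath.concat {E : V → V → Prop} {a b c : V} {p : List V}
    (hp : IsPath E a b p) (hbc : E b c) : IsPath E a c (p ++ [c]) := by
  obtain ⟨hne, hhead, hlast, hchain⟩ := hp
  refine ⟨by simp, by simp [hhead], by simp, ?_⟩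
  refine List.isChain_append.2 ⟨hchain, List.isChain_singleton c, ?_⟩
  simp_all

/-- if `a ∉ W`, `a` dominates every node of `W`, and no arc `(u,v)`
has `a ≥_s u`, `u ∉ {a} ∪ W` and `v ∈ W`, then `{a} ∪ W` is a module with source `a`. -/
theorem cone_is_module [Fintype V] (E : V → V → Prop) (s : V)
    (hreach : ∀ v : V, ∃ p : List V, IsPath E s v p)
    (a : V) (W : Set V) (haW : a ∉ W)
    (hdom : ∀ w ∈ W, Dom E s a w)
    (hnoarc : ¬ ∃ u v, E u v ∧ Dom E s a u ∧ u ∉ ({a} : Set V) ∪ W ∧ v ∈ W) :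
    ModuleSource E s (({a} : Set V) ∪ W) a := by
  refine ⟨Or.inl rfl, fun u v huv hu hv => ?_, fun hs => ?_⟩
  · rcases hv with hv | hv
    · exact hv
    · by_cases hau : Dom E s a u
      · exact absurd ⟨u, v, huv, hau, hu, hv⟩ hnoarc
      · simp only [Dom, not_forall] at hau
        obtain ⟨p, hp, hap⟩ := hau
        have hav := hdom v hv _ (hp.concat huv)
        rcases List.mem_append.1 hav with h | h
        · exact absurd h hap
        · exact (List.mem_singleton.1 h).symm
  · rcases hs with hs | hs
    · exact hs.symm
    · exact List.mem_singleton.1 (hdom s hs [s] (isPath_singleton E s))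
end

section
/- Let G = (V, E, s) be a graph in which every node is reachable from s and with |V| ≥ 2. For every a ∈ V and every j with 1 ≤ j ≤ k_a, the maximal module partition within the A-C family AC of the module M = {a} ∪ ⋃_{i=1}^{j} D(S^a_i) is exactly { {a} ∪ ⋃_{i=1}^{j-1} D(S^a_i) } ∪ { D(v) : v ∈ S^a_j }, and consequently the width of the nesting decomposition AC equals 1 + max{ |S^a_i| : a ∈ V, 1 ≤ i ≤ k_a }. -/
open Relation

variable {V : Type*}

theorem IsPath.reflTransGen {E : V → V → Prop} {Q : V → Prop} {p : List V} {a b : V}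
    (h : IsPath E a b p) (hQ : ∀ x ∈ p, Q x) : ReflTransGen (fun x y => E x y ∧ Q y) a b := by
  induction p generalizing a with
  | nil => exact absurd rfl h.1
  | cons x t ih =>
    obtain ⟨-, hx, hb, hc⟩ := h
    obtain rfl : x = a := by simpa using hx
    cases t with
    | nil =>
      obtain rfl : x = b := by simpa using hb
      exact .refl
    | cons y t =>
      have hc' : E x y ∧ List.IsChain E (y :: t) := List.isChain_cons_cons.1 hc
      exact .head ⟨hc'.1, hQ y (by simp)⟩
        (ih ⟨by simp, rfl, by simpa using hb, hc'.2⟩ (fun z hz => hQ z (List.mem_cons_of_mem _ hz)))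

theorem exists_isPath_of_reflTransGen {E : V → V → Prop} {d a b : V} (hda : d ≠ a)
    (h : ReflTransGen (fun x y => E x y ∧ y ≠ d) a b) : ∃ p, IsPath E a b p ∧ d ∉ p := by
  induction h using ReflTransGen.head_induction_on with
  | refl => exact ⟨[b], ⟨by simp, rfl, rfl, List.isChain_singleton b⟩, by simpa using hda⟩
  | @head x y hxy _ ih =>
    obtain ⟨p, ⟨hne, hh, hl, hc⟩, hdp⟩ := ih hxy.2.symm
    cases p with
    | nil => exact absurd rfl hne
    | cons z t =>
      obtain rfl : z = y := by simpa using hh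
      exact ⟨x :: z :: t, ⟨by simp, rfl, by simpa using hl, List.isChain_cons_cons.2 ⟨hxy.1, hc⟩⟩,
        by simpa [hda] using hdp⟩

theorem not_dom_iff {E : V → V → Prop} {s a b : V} :
    ¬ Dom E s a b ↔ a ≠ s ∧ ReflTransGen (fun x y => E x y ∧ y ≠ a) s b := by
  constructor
  · intro h
    simp only [Dom, not_forall] at h
    obtain ⟨p, hp, ha⟩ := h
    refine ⟨?_, hp.reflTransGen fun x hx => ne_of_mem_of_not_mem hx ha⟩
    rintro rfl
    exact ha (List.mem_of_mem_head? (by simp [hp.2.1]))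
  · rintro ⟨hs, h⟩ hd
    obtain ⟨p, hp, ha⟩ := exists_isPath_of_reflTransGen hs h
    exact ha (hd p hp)

theorem Dom.refl (E : V → V → Prop) (s a : V) : Dom E s a a := by
  by_contra h
  obtain ⟨hs, h⟩ := not_dom_iff.1 h
  rcases h.cases_tail with h | ⟨_, _, _, h⟩
  · exact hs h
  · exact h rfl

theorem dom_source (E : V → V → Prop) (s a : V) : Dom E s s a := by
  by_contra h
  exact (not_dom_iff.1 h).1 rfl

theorem Dom.eq_source {E : V → V → Prop} {s a : V} (h : Dom E s a s) : a = s := by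
  by_contra hs
  exact not_dom_iff.2 ⟨hs, .refl⟩ h

theorem Dom.of_arc {E : V → V → Prop} {s a x y : V} (h : Dom E s a y) (hxy : E x y)
    (ha : y ≠ a) : Dom E s a x := by
  by_contra hx
  obtain ⟨hs, hx⟩ := not_dom_iff.1 hx
  exact not_dom_iff.2 ⟨hs, hx.tail ⟨hxy, ha⟩⟩ h

theorem Dom.trans {E : V → V → Prop} {s a b c : V} (hab : Dom E s a b) (hbc : Dom E s b c) :
    Dom E s a c := by
  by_contra h
  rw [not_dom_iff] at h
  obtain ⟨hs, h⟩ := h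
  suffices ¬ Dom E s b c from this hbc
  clear hbc
  induction h with
  | refl =>
    intro hb
    obtain rfl := hb.eq_source
    exact hs hab.eq_source
  | @tail x y hx hxy ih =>
    intro hb
    by_cases hy : y = b
    · subst hy
      exact not_dom_iff.2 ⟨hs, hx.tail hxy⟩ hab
    · exact ih (hb.of_arc hxy.1 hy)

theorem IsPath.reachable {E : V → V → Prop} {a b : V} {p : List V} (h : IsPath E a b p) :
    ReflTransGen E a b :=
  ReflTransGen.mono (fun _ _ hxy => hxy.1) _ _
    (h.reflTransGen (Q := fun _ => True) fun _ _ => trivial)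

theorem Dom.antisymm {E : V → V → Prop} {s a b : V} (hr : ReflTransGen E s b)
    (hab : Dom E s a b) (hba : Dom E s b a) : a = b := by
  by_contra hne
  suffices ∀ x, ReflTransGen E s x → ¬ Dom E s a x from this b hr hab
  intro x hx
  induction hx with
  | refl =>
    intro h
    exact hne (h.eq_source.trans (hba.trans h).eq_source.symm)
  | @tail x y _ hxy ih =>
    intro h
    by_cases hy : y = a
    · exact ih (hab.trans ((hba.trans h).of_arc hxy (fun h' => hne (hy.symm.trans h'))))
    · exact ih (h.of_arc hxy hy)

theorem Dom.total {E : V → V → Prop} {s a b c : V} (hr : ReflTransGen E s c)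
    (hac : Dom E s a c) (hbc : Dom E s b c) : Dom E s a b ∨ Dom E s b a := by
  by_contra! hne
  induction hr with
  | refl =>
    obtain rfl := hac.eq_source
    exact hne.1 (dom_source E a b)
  | @tail x y _ hxy ih =>
    by_cases hya : y = a
    · exact hne.2 (hya ▸ hbc)
    by_cases hyb : y = b
    · exact hne.1 (hyb ▸ hac)
    exact ih (hac.of_arc hxy hya) (hbc.of_arc hxy hyb)

theorem IsChild.eq_of_dom {E : V → V → Prop} {s a v w x : V} (hr : ReflTransGen E s x)
    (hv : IsChild E s a v) (hw : IsChild E s a w) (hvx : Dom E s v x) (hwx : Dom E s w x) :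
    v = w := by
  by_contra hne
  rcases hvx.total hr hwx with h | h
  · exact hw.2.2 v hv.1 hne ⟨hv.2.1, h⟩
  · exact hv.2.2 w hw.1 (Ne.symm hne) ⟨hw.2.1, h⟩

theorem exists_isChild_dom [Finite V] {E : V → V → Prop} {s a c : V}
    (hr : ∀ v, ReflTransGen E s v) (hac : Dom E s a c) (hne : c ≠ a) :
    ∃ v, IsChild E s a v ∧ Dom E s v c := by
  obtain ⟨v, ⟨hva, hav, hvc⟩, hmax⟩ :=
    Set.exists_max_image {b | b ≠ a ∧ Dom E s a b ∧ Dom E s b c}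
      (fun b => (DomSet E s b).ncard) (Set.toFinite _) ⟨c, hne, hac, Dom.refl E s c⟩
  refine ⟨v, ⟨hva, hav, fun b hba hbv ⟨hab, hb⟩ => ?_⟩, hvc⟩
  refine (hmax b ⟨hba, hab, hb.trans hvc⟩).not_gt (Set.ncard_lt_ncard ?_ (Set.toFinite _))
  refine ⟨fun x hx => Dom.trans hb hx, fun h => hbv ?_⟩
  exact Dom.antisymm (hr v) hb (h (Dom.refl E s b))

theorem mem_prefixModule {E : V → V → Prop} {s a x : V} {L : List (Set V)} {j : ℕ} :
    x ∈ PrefixModule E s a L j ↔ x = a ∨ ∃ i < j, ∃ v ∈ L.getD i ∅, Dom E s v x := by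
  simp [PrefixModule, DSet, DomSet]

theorem prefixModule_mono (E : V → V → Prop) (s a : V) (L : List (Set V)) :
    Monotone (PrefixModule E s a L) := by
  intro i j hij x
  simp only [mem_prefixModule]
  rintro (h | ⟨k, hk, h⟩)
  · exact .inl h
  · exact .inr ⟨k, hk.trans_le hij, h⟩

theorem self_mem_prefixModule (E : V → V → Prop) (s a : V) (L : List (Set V)) (j : ℕ) :
    a ∈ PrefixModule E s a L j := mem_prefixModule.2 (.inl rfl)

namespace IsTopoSCCList

variable {E : V → V → Prop} {s a : V} {L : List (Set V)}

theorem isChild (hL : IsTopoSCCList E s a L) {i : ℕ} {v : V} (hv : v ∈ L.getD i ∅) :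
    IsChild E s a v := by
  by_cases hi : i < L.length
  · rw [List.getD_eq_getElem _ _ hi] at hv
    obtain ⟨u, -, hS⟩ := hL.1 _ (List.getElem_mem hi)
    rw [hS] at hv
    exact hv.1
  · rw [List.getD_eq_default _ _ (not_lt.1 hi)] at hv
    exact hv.elim

theorem index_eq (hL : IsTopoSCCList E s a L) {i j : ℕ} {v : V} (hi : v ∈ L.getD i ∅)
    (hj : v ∈ L.getD j ∅) : i = j := by
  have hv := hL.isChild hi
  have lt : ∀ {k}, v ∈ L.getD k ∅ → k < L.length := by
    intro k hk
    by_contra h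
    rw [List.getD_eq_default _ _ (not_lt.1 h)] at hk
    exact hk
  have := (hL.2.1 v hv).unique (y₁ := ⟨i, lt hi⟩) (y₂ := ⟨j, lt hj⟩)
    (by rwa [List.getD_eq_getElem _ _ (lt hi)] at hi)
    (by rwa [List.getD_eq_getElem _ _ (lt hj)] at hj)
  simpa using this

theorem exists_mem (hL : IsTopoSCCList E s a L) {v : V} (hv : IsChild E s a v) :
    ∃ i < L.length, v ∈ L.getD i ∅ := by
  obtain ⟨i, hi, -⟩ := hL.2.1 v hv
  exact ⟨i, i.2, by rwa [List.getD_eq_getElem _ _ i.2]⟩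

theorem nonempty (hL : IsTopoSCCList E s a L) {i : ℕ} (hi : i < L.length) :
    (L.getD i ∅).Nonempty := by
  rw [List.getD_eq_getElem _ _ hi]
  obtain ⟨u, hu, hS⟩ := hL.1 _ (List.getElem_mem hi)
  rw [hS]
  exact ⟨u, hu, .refl, .refl⟩

theorem prefixModule_subset (hL : IsTopoSCCList E s a L) (j : ℕ) :
    PrefixModule E s a L j ⊆ DomSet E s a := by
  intro x hx
  rcases mem_prefixModule.1 hx with rfl | ⟨i, -, v, hv, hvx⟩
  · exact Dom.refl E s x
  · exact (hL.isChild hv).2.1.trans hvx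

theorem prefixModule_length [Finite V] (hr : ∀ v, ReflTransGen E s v)
    (hL : IsTopoSCCList E s a L) : PrefixModule E s a L L.length = DomSet E s a := by
  refine (hL.prefixModule_subset _).antisymm fun x hx => mem_prefixModule.2 ?_
  by_cases hxa : x = a
  · exact .inl hxa
  · obtain ⟨v, hv, hvx⟩ := exists_isChild_dom hr hx hxa
    obtain ⟨i, hi, hvi⟩ := hL.exists_mem hv
    exact .inr ⟨i, hi, v, hvi, hvx⟩

theorem not_dom_self (hr : ∀ v, ReflTransGen E s v) (hL : IsTopoSCCList E s a L) {i : ℕ} {v : V}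
    (hv : v ∈ L.getD i ∅) : ¬ Dom E s v a := fun h =>
  (hL.isChild hv).1 (h.antisymm (hr a) (hL.isChild hv).2.1)

theorem disjoint_prefixModule_domSet (hr : ∀ v, ReflTransGen E s v)
    (hL : IsTopoSCCList E s a L) {j : ℕ} {v : V} (hv : v ∈ L.getD j ∅) :
    Disjoint (PrefixModule E s a L j) (DomSet E s v) := by
  refine Set.disjoint_left.2 fun x hx hvx => ?_
  rcases mem_prefixModule.1 hx with rfl | ⟨i, hi, w, hw, hwx⟩
  · exact hL.not_dom_self hr hv hvx
  · obtain rfl := (hL.isChild hv).eq_of_dom (hr x) (hL.isChild hw) hvx hwx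
    exact hi.ne (hL.index_eq hw hv)

end IsTopoSCCList

theorem maxPartition_eq_of_antichain {F P : Set (Set V)} {M : Set V}
    (hP : ∀ T ∈ P, T ∈ F ∧ T ⊂ M) (hcover : ∀ H ∈ F, H ⊂ M → ∃ T ∈ P, H ⊆ T)
    (hanti : IsAntichain (· ⊆ ·) P) : MaxPartition F M = P := by
  ext H
  constructor
  · rintro ⟨hF, hM, hmax⟩
    obtain ⟨T, hT, hHT⟩ := hcover H hF hM
    rcases hHT.eq_or_ssubset with rfl | h
    · exact hT
    · exact absurd ⟨T, (hP T hT).1, h, (hP T hT).2⟩ hmax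
  · intro hH
    refine ⟨(hP H hH).1, (hP H hH).2, ?_⟩
    rintro ⟨K, hK, hHK, hKM⟩
    obtain ⟨T, hT, hKT⟩ := hcover K hK hKM
    have hHT : H ⊂ T := hHK.trans_subset hKT
    exact hanti hH hT hHT.ne hHT.subset

theorem domSet_injective {E : V → V → Prop} {s : V} (hr : ∀ v, ReflTransGen E s v) :
    Function.Injective (DomSet E s) := fun v w h =>
  Dom.antisymm (hr w) (show w ∈ DomSet E s v from h ▸ Dom.refl E s w)
    (show v ∈ DomSet E s w from h ▸ Dom.refl E s v)

theorem maxPartition_prefixModule_succ [Finite V] {E : V → V → Prop} {s : V}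
    (hr : ∀ v, ReflTransGen E s v) {L : V → List (Set V)}
    (hL : ∀ a, IsTopoSCCList E s a (L a)) {a : V} {j : ℕ} (hj : j < (L a).length) :
    MaxPartition (ACFamily E s L) (PrefixModule E s a (L a) (j + 1)) =
      insert (PrefixModule E s a (L a) j) (DomSet E s '' (L a).getD j ∅) := by
  have hdisj : ∀ v ∈ (L a).getD j ∅, Disjoint (PrefixModule E s a (L a) j) (DomSet E s v) :=
    fun v hv => (hL a).disjoint_prefixModule_domSet hr hv
  apply maxPartition_eq_of_antichain
  · rintro T (rfl | ⟨v, hv, rfl⟩)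
    · refine ⟨⟨a, j, hj.le, rfl⟩, prefixModule_mono E s a (L a) j.le_succ, fun h => ?_⟩
      obtain ⟨v, hv⟩ := (hL a).nonempty hj
      exact Set.disjoint_left.1 (hdisj v hv)
        (h (mem_prefixModule.2 (.inr ⟨j, j.lt_succ_self, v, hv, Dom.refl E s v⟩)))
        (Dom.refl E s v)
    · refine ⟨⟨v, _, le_rfl, ((hL v).prefixModule_length hr).symm⟩,
        fun x hx => mem_prefixModule.2 (.inr ⟨j, j.lt_succ_self, v, hv, hx⟩), fun h => ?_⟩
      exact (hL a).not_dom_self hr hv (h (self_mem_prefixModule E s a (L a) _))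
  · rintro _ ⟨b, i, -, rfl⟩ hb
    rcases mem_prefixModule.1 (hb.subset (self_mem_prefixModule E s b (L b) i)) with
      rfl | ⟨l, hl, v, hv, hvb⟩
    · refine ⟨_, .inl rfl, prefixModule_mono E s b (L b) ?_⟩
      by_contra! h
      exact hb.2 (prefixModule_mono E s b (L b) h)
    · have hbv : PrefixModule E s b (L b) i ⊆ DomSet E s v := fun x hx =>
        Dom.trans hvb ((hL b).prefixModule_subset i hx)
      rcases (Nat.lt_succ_iff.1 hl).eq_or_lt with rfl | hlj
      · exact ⟨_, .inr ⟨v, hv, rfl⟩, hbv⟩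
      · exact ⟨_, .inl rfl, fun x hx => mem_prefixModule.2 (.inr ⟨l, hlj, v, hv, hbv hx⟩)⟩
  · rintro T (rfl | ⟨v, hv, rfl⟩) U (rfl | ⟨w, hw, rfl⟩) hne hsub
    · exact hne rfl
    · have ha := self_mem_prefixModule E s a (L a) j
      exact Set.disjoint_left.1 (hdisj w hw) ha (hsub ha)
    · exact Set.disjoint_left.1 (hdisj v hv) (hsub (Dom.refl E s v)) (Dom.refl E s v)
    · exact hne (congrArg _ (((hL a).isChild hv).eq_of_dom (hr v) ((hL a).isChild hw)
        (Dom.refl E s v) (hsub (Dom.refl E s v))))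

theorem ncard_maxPartition_prefixModule_succ [Finite V] {E : V → V → Prop} {s : V}
    (hr : ∀ v, ReflTransGen E s v) {L : V → List (Set V)}
    (hL : ∀ a, IsTopoSCCList E s a (L a)) {a : V} {j : ℕ} (hj : j < (L a).length) :
    (MaxPartition (ACFamily E s L) (PrefixModule E s a (L a) (j + 1))).ncard =
      1 + ((L a).getD j ∅).ncard := by
  rw [maxPartition_prefixModule_succ hr hL hj, Set.ncard_insert_of_notMem,
    Set.ncard_image_of_injective _ (domSet_injective hr), add_comm]
  rintro ⟨v, hv, h⟩
  exact (hL a).not_dom_self hr hv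
    (show a ∈ DomSet E s v from h ▸ self_mem_prefixModule E s a (L a) j)

theorem maxPartition_prefixModule_zero (E : V → V → Prop) (s : V) (L : V → List (Set V)) (a : V) :
    MaxPartition (ACFamily E s L) (PrefixModule E s a (L a) 0) = ∅ := by
  refine Set.eq_empty_of_forall_notMem ?_
  rintro _ ⟨⟨b, i, -, rfl⟩, hb, -⟩
  have hb' : b = a := by
    simpa [mem_prefixModule] using hb.subset (self_mem_prefixModule E s b (L b) i)
  subst hb'
  exact hb.2 (prefixModule_mono E s b (L b) i.zero_le)

theorem ncard_maxPartition_le_NDWidth [Finite V] {F : Set (Set V)} {M : Set V} (hM : M ∈ F) :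
    (MaxPartition F M).ncard ≤ NDWidth F := by
  refine le_trans ?_ (le_ciSup (Set.finite_range _).bddAbove M)
  rw [ciSup_pos hM]

theorem ncard_le_MaxSCCSize [Finite V] (L : V → List (Set V)) {a : V} {i : ℕ}
    (hi : i < (L a).length) : ((L a).getD i ∅).ncard ≤ MaxSCCSize L := by
  refine le_trans ?_ (le_ciSup (Set.finite_range _).bddAbove a)
  have hbdd : BddAbove (Set.range fun i =>
      ⨆ _ : i ∈ Finset.range (L a).length, ((L a).getD i ∅).ncard) := by
    refine ⟨Nat.card V, ?_⟩
    rintro _ ⟨k, rfl⟩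
    exact ciSup_le' fun _ => Set.ncard_le_card _
  refine le_trans ?_ (le_ciSup hbdd i)
  rw [ciSup_pos (Finset.mem_range.2 hi)]

theorem NDWidth_ACFamily [Finite V] [Nontrivial V] {E : V → V → Prop} {s : V}
    (hr : ∀ v, ReflTransGen E s v) {L : V → List (Set V)}
    (hL : ∀ a, IsTopoSCCList E s a (L a)) :
    NDWidth (ACFamily E s L) = 1 + MaxSCCSize L := by
  have hle : ∀ (a : V) (i : ℕ), i < (L a).length →
      1 + ((L a).getD i ∅).ncard ≤ NDWidth (ACFamily E s L) := by
    intro a i hi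
    rw [← ncard_maxPartition_prefixModule_succ hr hL hi]
    exact ncard_maxPartition_le_NDWidth ⟨a, i + 1, hi, rfl⟩
  apply le_antisymm
  · refine ciSup_le' fun M => ciSup_le' ?_
    rintro ⟨a, j, hj, rfl⟩
    cases j with
    | zero => simp [maxPartition_prefixModule_zero]
    | succ j =>
      rw [ncard_maxPartition_prefixModule_succ hr hL hj]
      exact Nat.add_le_add_left (ncard_le_MaxSCCSize L hj) 1
  · have hpos : 1 ≤ NDWidth (ACFamily E s L) := by
      obtain ⟨x, hx⟩ := exists_ne s
      obtain ⟨v, hv, -⟩ := exists_isChild_dom hr (dom_source E s x) hx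
      obtain ⟨i, hi, -⟩ := (hL s).exists_mem hv
      exact (Nat.le_add_right _ _).trans (hle s i hi)
    have : MaxSCCSize L ≤ NDWidth (ACFamily E s L) - 1 := by
      refine ciSup_le' fun a => ciSup_le' fun i => ciSup_le' fun hi => ?_
      have := hle a i (Finset.mem_range.1 hi)
      omega
    omega

/-- for every `a` and `1 ≤ j ≤ k_a`, the maximal module partition of
`M = {a} ∪ ⋃_{i=1}^{j} D(S^a_i)` within the A-C family is exactly
`{ {a} ∪ ⋃_{i=1}^{j-1} D(S^a_i) } ∪ { D(v) : v ∈ S^a_j }`, and consequently the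
width of the A-C family equals `1 + max{ |S^a_i| }`. -/
theorem ACFamily_maxPartition_and_width [Fintype V] (E : V → V → Prop) (s : V)
    (hreach : ∀ v : V, ∃ p : List V, IsPath E s v p)
    (hcard : 2 ≤ Fintype.card V)
    (L : V → List (Set V)) (hL : ∀ a : V, IsTopoSCCList E s a (L a)) :
    (∀ (a : V) (j : ℕ), 1 ≤ j → j ≤ (L a).length →
      MaxPartition (ACFamily E s L) (PrefixModule E s a (L a) j) =
        insert (PrefixModule E s a (L a) (j - 1))
          {T : Set V | ∃ v ∈ (L a).getD (j - 1) ∅, T = DomSet E s v}) ∧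
    NDWidth (ACFamily E s L) = 1 + MaxSCCSize L := by
  have hr : ∀ v, ReflTransGen E s v := fun v => (hreach v).choose_spec.reachable
  have : Nontrivial V := Fintype.one_lt_card_iff_nontrivial.1 hcard
  refine ⟨fun a j hj hjL => ?_, NDWidth_ACFamily hr hL⟩
  obtain ⟨j, rfl⟩ := Nat.exists_eq_add_of_le' hj
  rw [maxPartition_prefixModule_succ hr hL hjL]
  simp only [Nat.add_sub_cancel, Set.image, eq_comm]
end
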